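/- arXiv:2203.11577 — 2 statements merged into one kernel-verified Lean document; each statement's English description precedes it below -/
import Mathlib

section
/- Let N be a nonempty countable set and let NK_ω be the loopless graph with vertex set N × ℕ in which distinct vertices (i, a) and (j, b) are adjacent if and only if i = j (the disjoint union of |N| copies of the countably infinite complete graph). Then the endomorphism monoid End(NK_ω) possesses infinitely many pairwise distinct Polish semigroup topologies. -/
variable {G : Type*}

/-- The extension property characterising the random graph: for all disjoint
finite sets `U`, `V` of vertices there is a vertex outside `U ∪ V` adjacent to
everything in `U` and to nothing in `V`. -/
def ExtensionProperty (adj : G → G → Prop) : Prop :=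
  ∀ U V : Finset G, (∀ x ∈ U, x ∉ V) →
    ∃ w : G, w ∉ U ∧ w ∉ V ∧ (∀ u ∈ U, adj w u) ∧ (∀ v ∈ V, ¬ adj w v)

/-- The endomorphism monoid of the graph `(G, adj)`, as a set of functions. -/
def graphEnd (adj : G → G → Prop) : Set (G → G) :=
  {f : G → G | ∀ x y : G, adj x y → adj (f x) (f y)}

theorem graphEnd_comp (adj : G → G → Prop) :
    ∀ f ∈ graphEnd adj, ∀ g ∈ graphEnd adj, g ∘ f ∈ graphEnd adj :=
  fun _ hf _ hg x y h => hg _ _ (hf x y h)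

/-- The topology of pointwise convergence on a set `S` of self-maps of `X`,
where `X` carries the discrete topology. -/
def pointwiseTop (X : Type*) (S : Set (X → X)) : TopologicalSpace ↥S :=
  TopologicalSpace.generateFrom
    {U : Set ↥S | ∃ x y : X, U = {f : ↥S | f.1 x = y}}

/-- `τ` is a Polish semigroup topology on the set `S` of self-maps of `X`
(a semigroup under composition in diagrammatic order, `hS` witnessing closure
under composition): `τ` is Polish and composition is continuous. -/
def IsPolishSemigroupTop {X : Type*} {S : Set (X → X)}
    (hS : ∀ f ∈ S, ∀ g ∈ S, g ∘ f ∈ S) (τ : TopologicalSpace ↥S) : Prop :=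
  @PolishSpace ↥S τ ∧
    @Continuous (↥S × ↥S) ↥S (@instTopologicalSpaceProd ↥S ↥S τ τ) τ
      (fun p => ⟨p.2.1 ∘ p.1.1, hS p.1.1 p.1.2 p.2.1 p.2.2⟩)

/-- The adjacency relation of the graph `NK_ω`: the disjoint union of `|N|`
copies of the countably infinite complete graph (no loops). -/
def nKomega (N : Type*) : (N × ℕ) → (N × ℕ) → Prop :=
  fun u v => u.1 = v.1 ∧ u ≠ v

open Set Filter Topology

theorem IsGδ.polishSpace_subtype {X : Type*} [TopologicalSpace X] [PolishSpace X] {s : Set X}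
    (hs : IsGδ s) : PolishSpace s := by
  obtain ⟨U, hU, rfl⟩ := hs.eq_iInter_nat
  have (k : ℕ) : PolishSpace (U k) := (hU k).polishSpace
  let diag : ↥(⋂ k, U k) → ∀ k, U k := fun x k => ⟨x.1, mem_iInter.1 x.2 k⟩
  have h_diag : Continuous diag :=
    continuous_pi fun k => continuous_subtype_val.subtype_mk _
  have h_proj : Continuous fun y : ∀ k, U k => (y 0).1 :=
    continuous_subtype_val.comp (continuous_apply 0)
  have h_emb : IsEmbedding diag :=
    .of_comp h_diag h_proj (g := fun y : ∀ k, U k => (y 0).1) IsEmbedding.subtypeVal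
  have h_range : range diag = ⋂ k, {y | (y k).1 = (y 0).1} := by
    ext y
    simp only [mem_range, mem_iInter, mem_ofPred_eq]
    constructor
    · rintro ⟨x, rfl⟩ k
      rfl
    · intro hy
      refine ⟨⟨(y 0).1, mem_iInter.2 fun k => hy k ▸ (y k).2⟩, ?_⟩
      ext k
      exact (hy k).symm
  refine IsClosedEmbedding.polishSpace (f := diag) ⟨h_emb, ?_⟩
  rw [h_range]
  exact isClosed_iInter fun k =>
    isClosed_eq (continuous_subtype_val.comp (continuous_apply k)) h_proj

theorem isGδ_setOf_iff {X : Type*} [TopologicalSpace X]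
    [TopologicalSpace.MetrizableSpace X] {P Q : X → Prop}
    (hP : IsOpen {x | P x}) (hQ : IsOpen {x | Q x}) : IsGδ {x | P x ↔ Q x} := by
  let := TopologicalSpace.metrizableSpaceMetric X
  have h : {x | P x ↔ Q x} = ({x | P x}ᶜ ∪ {x | Q x}) ∩ ({x | Q x}ᶜ ∪ {x | P x}) := by
    ext x
    simp only [mem_ofPred_eq, mem_inter_iff, mem_union, mem_compl_iff]
    tauto
  rw [h]
  exact (hP.isClosed_compl.isGδ.union hQ.isGδ).inter (hQ.isClosed_compl.isGδ.union hP.isGδ)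

theorem ENat.natCast_le_add_iff {k : ℕ} {a b : ℕ∞} :
    (k : ℕ∞) ≤ a + b ↔ ∃ p ≤ k, (p : ℕ∞) ≤ a ∧ ((k - p : ℕ) : ℕ∞) ≤ b := by
  constructor
  · intro h
    induction a using ENat.recTopCoe with
    | top => exact ⟨k, le_rfl, by simp, by simp⟩
    | coe a =>
      induction b using ENat.recTopCoe with
      | top => exact ⟨0, by simp, by simp, by simp⟩
      | coe b =>
        have h : k ≤ a + b := by exact_mod_cast h
        exact ⟨min k a, min_le_left _ _, by simp, by norm_cast; omega⟩
  · rintro ⟨p, hp, ha, hb⟩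
    calc (k : ℕ∞) = (p : ℕ∞) + ((k - p : ℕ) : ℕ∞) := by norm_cast; omega
      _ ≤ a + b := add_le_add ha hb

theorem Set.natCast_le_encard_iff {α : Type*} {s : Set α} {k : ℕ} :
    (k : ℕ∞) ≤ s.encard ↔ ∃ F : Finset α, F.card = k ∧ ∀ v ∈ F, v ∈ s := by
  constructor
  · intro h
    obtain ⟨t, hts, ht⟩ := exists_subset_encard_eq h
    have hfin : t.Finite := finite_of_encard_eq_coe ht
    refine ⟨hfin.toFinset, ?_, fun v hv => hts (hfin.mem_toFinset.1 hv)⟩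
    rw [hfin.encard_eq_coe_toFinset_card] at ht
    exact_mod_cast ht
  · rintro ⟨F, rfl, hF⟩
    rw [← encard_coe_eq_coe_finsetCard]
    exact encard_le_encard hF

namespace NKomega

variable {N : Type*}

theorem fst_eq {f : N × ℕ → N × ℕ} (hf : f ∈ graphEnd (nKomega N)) {u v : N × ℕ}
    (h : u.1 = v.1) : (f u).1 = (f v).1 := by
  by_cases huv : u = v
  · rw [huv]
  · exact (hf u v ⟨h, huv⟩).1

theorem eq_of_apply_eq {f : N × ℕ → N × ℕ} (hf : f ∈ graphEnd (nKomega N)) {u v : N × ℕ}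
    (h : u.1 = v.1) (huv : f u = f v) : u = v := by
  by_contra hne
  exact (hf u v ⟨h, hne⟩).2 huv

/-- The vertices of the component containing the image of the `i`-th component which are not
in that image. -/
def missed (f : N × ℕ → N × ℕ) (i : N) : Set (N × ℕ) :=
  {v | v.1 = (f (i, 0)).1 ∧ ¬ ∃ a, f (i, a) = v}

/-- The number of vertices missed by the restriction of `f` to the `i`-th component. -/
noncomputable def defect (f : N × ℕ → N × ℕ) (i : N) : ℕ∞ := (missed f i).encard

theorem missed_comp {f g : N × ℕ → N × ℕ} (hf : f ∈ graphEnd (nKomega N))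
    (hg : g ∈ graphEnd (nKomega N)) (i : N) :
    missed (g ∘ f) i = missed g (f (i, 0)).1 ∪ g '' missed f i := by
  ext v
  constructor
  · rintro ⟨hv, hv'⟩
    by_cases h : ∃ a, g ((f (i, 0)).1, a) = v
    · obtain ⟨a, rfl⟩ := h
      refine Or.inr ⟨((f (i, 0)).1, a), ⟨rfl, ?_⟩, rfl⟩
      rintro ⟨b, hb⟩
      exact hv' ⟨b, by simp [hb]⟩
    · exact Or.inl ⟨hv.trans (fst_eq hg rfl), h⟩
  · rintro (⟨hv, hv'⟩ | ⟨u, ⟨hu, hu'⟩, rfl⟩)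
    · refine ⟨hv.trans (fst_eq hg rfl), ?_⟩
      rintro ⟨a, rfl⟩
      refine hv' ⟨(f (i, a)).2, ?_⟩
      rw [fst_eq hf (u := (i, 0)) (v := (i, a)) rfl]
      rfl
    · refine ⟨fst_eq hg hu, ?_⟩
      rintro ⟨a, ha⟩
      exact hu' ⟨a, eq_of_apply_eq hg ((fst_eq hf (u := (i, a)) (v := (i, 0)) rfl).trans hu.symm) ha⟩

theorem defect_comp {f g : N × ℕ → N × ℕ} (hf : f ∈ graphEnd (nKomega N))
    (hg : g ∈ graphEnd (nKomega N)) (i : N) :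
    defect (g ∘ f) i = defect g (f (i, 0)).1 + defect f i := by
  rw [defect, missed_comp hf hg, encard_union_eq, InjOn.encard_image]
  · rfl
  · exact fun u hu v hv => eq_of_apply_eq hg (hu.1.trans hv.1.symm)
  · rw [Set.disjoint_left]
    rintro _ hv ⟨u, hu, rfl⟩
    refine hv.2 ⟨u.2, ?_⟩
    rw [← hu.1]

/-- The space of codes of endomorphisms: an endomorphism is coded by its values, by the graph of
its component images, and by its defects truncated at `n`. -/
abbrev Code (N : Type*) (n : ℕ) : Type _ :=
  (N × ℕ → N × ℕ) × (N × N × ℕ → Bool) × (N × Fin (n + 1) → Bool)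

open Classical in
/-- The code of an endomorphism. -/
noncomputable def code (n : ℕ) (f : ↥(graphEnd (nKomega N))) : Code N n :=
  (f.1, fun p => decide (∃ a, f.1 (p.1, a) = p.2),
    fun p => decide ((p.2.1 : ℕ∞) ≤ defect f.1 p.1))

theorem code_injective (n : ℕ) : Function.Injective (code (N := N) n) :=
  fun _ _ h => Subtype.ext (congrArg Prod.fst h)

theorem range_code (n : ℕ) : range (code (N := N) n) =
    (⋂ u, ⋂ v, {x | nKomega N u v → nKomega N (x.1 u) (x.1 v)}) ∩
    (⋂ i, ⋂ v, {x | x.2.1 (i, v) = true ↔ ∃ a, x.1 (i, a) = v}) ∩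
    (⋂ i, ⋂ k : Fin (n + 1), {x | x.2.2 (i, k) = true ↔ (k.1 : ℕ∞) ≤
      {v | v.1 = (x.1 (i, 0)).1 ∧ x.2.1 (i, v) = false}.encard}) := by
  ext x
  simp only [mem_range, mem_inter_iff, mem_iInter, mem_ofPred_eq]
  constructor
  · rintro ⟨f, rfl⟩
    refine ⟨⟨f.2, fun i v => by simp [code]⟩, fun i k => ?_⟩
    simp [code, defect, missed]
  · rintro ⟨⟨hf, hb⟩, he⟩
    refine ⟨⟨x.1, hf⟩, ?_⟩
    refine Prod.ext rfl (Prod.ext ?_ ?_)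
    · ext ⟨i, v⟩
      simp [code, ← hb]
    · ext ⟨i, k⟩
      simp only [code, defect, missed, ← hb, Bool.not_eq_true, ← he, Bool.decide_eq_true]

/-- The topology generated by the values, the membership in the component images, and the
defects truncated at `n`. -/
@[reducible]
noncomputable def defectTop (N : Type*) [TopologicalSpace N] (n : ℕ) :
    TopologicalSpace ↥(graphEnd (nKomega N)) :=
  TopologicalSpace.induced (code n) inferInstance

section

variable [TopologicalSpace N] [DiscreteTopology N]

theorem tendsto_defectTop_iff {n : ℕ} {α : Type*} {l : Filter α}
    {F : α → ↥(graphEnd (nKomega N))} {f : ↥(graphEnd (nKomega N))} :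
    Tendsto F l (@nhds _ (defectTop N n) f) ↔
      (∀ u, ∀ᶠ x in l, (F x).1 u = f.1 u) ∧
      (∀ i v, ∀ᶠ x in l, (∃ a, (F x).1 (i, a) = v) ↔ ∃ a, f.1 (i, a) = v) ∧
      (∀ i, ∀ k ≤ n, ∀ᶠ x in l, (k : ℕ∞) ≤ defect (F x).1 i ↔ (k : ℕ∞) ≤ defect f.1 i) := by
  rw [defectTop, nhds_induced, tendsto_comap_iff]
  simp only [code, nhds_prod_eq, tendsto_prod_iff', tendsto_pi_nhds, nhds_discrete, tendsto_pure,
    Function.comp_def, decide_eq_decide, Prod.forall, Fin.forall_iff, Nat.lt_succ_iff]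

theorem isOpen_setOf_le_encard {n k : ℕ} (i : N) :
    IsOpen {x : Code N n | (k : ℕ∞) ≤
      {v | v.1 = (x.1 (i, 0)).1 ∧ x.2.1 (i, v) = false}.encard} := by
  have h : {x : Code N n | (k : ℕ∞) ≤
      {v | v.1 = (x.1 (i, 0)).1 ∧ x.2.1 (i, v) = false}.encard} =
      ⋃ F : {F : Finset (N × ℕ) // F.card = k}, ⋂ v ∈ F.1,
        {x | v.1 = (x.1 (i, 0)).1} ∩ {x | x.2.1 (i, v) = false} := by
    ext x
    simp [Set.natCast_le_encard_iff]
  rw [h]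
  refine isOpen_iUnion fun F => isOpen_biInter_finset fun v _ => ?_
  refine IsOpen.inter ?_ ?_
  · exact (isOpen_discrete {w : N × ℕ | v.1 = w.1}).preimage
      (f := fun x : Code N n => x.1 (i, 0)) (by fun_prop)
  · exact (isOpen_discrete {false}).preimage
      (f := fun x : Code N n => x.2.1 (i, v)) (by fun_prop)

theorem isGδ_range_code [Countable N] (n : ℕ) : IsGδ (range (code (N := N) n)) := by
  let := TopologicalSpace.metrizableSpaceMetric (Code N n)
  rw [range_code]
  refine (IsGδ.inter ?_ ?_).inter ?_
  · refine .iInter fun u => .iInter fun v => IsOpen.isGδ ?_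
    exact (isOpen_discrete {w : (N × ℕ) × (N × ℕ) | nKomega N u v → nKomega N w.1 w.2}).preimage
      (f := fun x : Code N n => (x.1 u, x.1 v)) (by fun_prop)
  · refine .iInter fun i => .iInter fun v => isGδ_setOf_iff ?_ ?_
    · exact (isOpen_discrete {true}).preimage
        (f := fun x : Code N n => x.2.1 (i, v)) (by fun_prop)
    · simp only [Set.ofPred_exists]
      exact isOpen_iUnion fun a => (isOpen_discrete {v}).preimage
        (f := fun x : Code N n => x.1 (i, a)) (by fun_prop)
  · refine .iInter fun i => .iInter fun k => isGδ_setOf_iff ?_ (isOpen_setOf_le_encard i)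
    exact (isOpen_discrete {true}).preimage
      (f := fun x : Code N n => x.2.2 (i, k)) (by fun_prop)

theorem polishSpace_defectTop [Countable N] (n : ℕ) :
    @PolishSpace _ (defectTop N n) := by
  have : SecondCountableTopology N := DiscreteTopology.secondCountableTopology_of_countable
  have : PolishSpace (Code N n) := { }
  have := (isGδ_range_code (N := N) n).polishSpace_subtype
  have h := (Equiv.ofInjective _ (code_injective (N := N) n)).polishSpace_induced
  rwa [instTopologicalSpaceSubtype, induced_compose] at h

theorem continuous_comp_defectTop (n : ℕ) :
    letI := defectTop N n
    Continuous fun p : ↥(graphEnd (nKomega N)) × ↥(graphEnd (nKomega N)) =>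
      (⟨p.2.1 ∘ p.1.1, graphEnd_comp _ p.1.1 p.1.2 p.2.1 p.2.2⟩ : ↥(graphEnd (nKomega N))) := by
  let := defectTop N n
  refine continuous_iff_continuousAt.2 fun ⟨f, g⟩ => ?_
  obtain ⟨f_val, f_mem, f_def⟩ := tendsto_defectTop_iff.1 (continuousAt_fst (p := (f, g)))
  obtain ⟨g_val, g_mem, g_def⟩ := tendsto_defectTop_iff.1 (continuousAt_snd (p := (f, g)))
  refine tendsto_defectTop_iff.2 ⟨fun u => ?_, fun i v => ?_, fun i k hk => ?_⟩
  · filter_upwards [f_val u, g_val (f.1 u)] with p hp hp'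
    simp [hp, hp']
  · by_cases h : ∃ a, g.1 (f.1 (i, a)) = v
    · obtain ⟨a, ha⟩ := h
      filter_upwards [f_val (i, a), g_val (f.1 (i, a))] with p hp hp'
      exact iff_of_true ⟨a, by simp [hp, hp', ha]⟩ ⟨a, ha⟩
    · by_cases h' : ∃ c, g.1 ((f.1 (i, 0)).1, c) = v
      · obtain ⟨c, hc⟩ := h'
        filter_upwards [f_val (i, 0), f_mem i ((f.1 (i, 0)).1, c),
          g_val ((f.1 (i, 0)).1, c)] with p hp hp' hp''
        refine iff_of_false ?_ h
        rintro ⟨a, ha⟩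
        obtain ⟨b, hb⟩ := hp'.1 ⟨a, eq_of_apply_eq p.2.2
          (by rw [← hp]; exact fst_eq p.1.2 rfl) (ha.trans (hc.symm.trans hp''.symm))⟩
        exact h ⟨b, by rw [hb, hc]⟩
      · filter_upwards [f_val (i, 0), g_mem (f.1 (i, 0)).1 v] with p hp hp'
        refine iff_of_false ?_ h
        rintro ⟨a, ha⟩
        refine h' (hp'.1 ⟨(p.1.1 (i, a)).2, ?_⟩)
        rw [← hp, fst_eq p.1.2 (u := (i, 0)) (v := (i, a)) rfl]
        exact ha
  · have hF : ∀ᶠ p in 𝓝 (f, g), ∀ q ∈ Iic k,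
        ((q : ℕ∞) ≤ defect p.1.1 i ↔ (q : ℕ∞) ≤ defect f.1 i) :=
      (eventually_all_finite (finite_Iic k)).2 fun q hq => f_def i q (le_trans hq hk)
    have hG : ∀ᶠ p in 𝓝 (f, g), ∀ q ∈ Iic k,
        ((q : ℕ∞) ≤ defect p.2.1 (f.1 (i, 0)).1 ↔ (q : ℕ∞) ≤ defect g.1 (f.1 (i, 0)).1) :=
      (eventually_all_finite (finite_Iic k)).2 fun q hq => g_def _ q (le_trans hq hk)
    filter_upwards [f_val (i, 0), hF, hG] with p hp hpF hpG
    rw [defect_comp p.1.2 p.2.2, defect_comp f.2 g.2, hp, ENat.natCast_le_add_iff,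
      ENat.natCast_le_add_iff]
    refine exists_congr fun q => and_congr_right fun hq => ?_
    rw [hpG q hq, hpF (k - q) (Nat.sub_le k q)]

end

/-- The endomorphism acting on every component by the same injection. -/
def diagonal (N : Type*) (h : ℕ → ℕ) (hh : Function.Injective h) : ↥(graphEnd (nKomega N)) :=
  ⟨fun u => (u.1, h u.2), fun _ _ huv =>
    ⟨huv.1, fun e => huv.2 (Prod.ext huv.1 (hh (congrArg Prod.snd e)))⟩⟩

theorem defect_diagonal {h : ℕ → ℕ} (hh : Function.Injective h) (i : N) :
    defect (diagonal N h hh).1 i = ((range h)ᶜ).encard := by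
  have : missed (diagonal N h hh).1 i = Prod.mk i '' (range h)ᶜ := by
    ext ⟨j, b⟩
    simp only [missed, diagonal, mem_ofPred_eq, mem_image, mem_compl_iff, mem_range, Prod.mk.injEq]
    constructor
    · rintro ⟨rfl, h⟩
      exact ⟨b, fun ⟨y, hy⟩ => h ⟨y, rfl, hy⟩, rfl, rfl⟩
    · rintro ⟨c, hc, rfl, rfl⟩
      exact ⟨rfl, fun ⟨y, _, hy⟩ => hc ⟨y, hy⟩⟩
  rw [defect, this, (Prod.mk_right_injective i).encard_image]

/-- The injection of `ℕ` missing exactly the numbers less than `n` and the number `n + k`. -/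
def gapShift (n k x : ℕ) : ℕ := if x < k then x + n else x + n + 1

theorem gapShift_injective (n k : ℕ) : Function.Injective (gapShift n k) := by
  intro x y h
  simp only [gapShift] at h
  split_ifs at h <;> omega

theorem encard_compl_range_add (n : ℕ) : ((range (· + n))ᶜ : Set ℕ).encard = n := by
  have : ((range (· + n))ᶜ : Set ℕ) = ↑(Finset.range n) := by
    ext v
    simp only [mem_compl_iff, mem_range, Finset.coe_range, mem_Iio, ← not_le]
    exact not_congr ⟨fun ⟨y, hy⟩ => by omega, fun h => ⟨v - n, by omega⟩⟩
  rw [this, encard_coe_eq_coe_finsetCard, Finset.card_range]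

theorem encard_compl_range_gapShift (n k : ℕ) :
    ((range (gapShift n k))ᶜ : Set ℕ).encard = (n + 1 : ℕ) := by
  have : ((range (gapShift n k))ᶜ : Set ℕ) = ↑(insert (n + k) (Finset.range n)) := by
    ext v
    simp only [mem_compl_iff, mem_range, Finset.coe_insert, Finset.coe_range, mem_insert_iff,
      mem_Iio]
    constructor
    · intro h
      by_contra hv
      by_cases hvk : v < n + k
      · exact h ⟨v - n, by simp only [gapShift]; split_ifs <;> omega⟩
      · exact h ⟨v - n - 1, by simp only [gapShift]; split_ifs <;> omega⟩
    · rintro hv ⟨y, hy⟩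
      simp only [gapShift] at hy
      split_ifs at hy <;> omega
  rw [this, encard_coe_eq_coe_finsetCard, Finset.card_insert_of_notMem (by simp),
    Finset.card_range]

variable [TopologicalSpace N] [DiscreteTopology N]

theorem tendsto_diagonal_gapShift (n : ℕ) :
    Tendsto (fun k => diagonal N (gapShift n k) (gapShift_injective n k)) atTop
      (@nhds _ (defectTop N n) (diagonal N (· + n) (add_left_injective n))) := by
  refine tendsto_defectTop_iff.2 ⟨fun u => ?_, fun i v => ?_, fun i q hq => ?_⟩
  · filter_upwards [eventually_gt_atTop u.2] with k hk
    simp [diagonal, gapShift, hk]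
  · filter_upwards [eventually_gt_atTop v.2] with k hk
    refine exists_congr fun a => ?_
    simp only [diagonal, gapShift, Prod.ext_iff]
    refine and_congr_right fun _ => ?_
    split_ifs <;> omega
  · refine Eventually.of_forall fun k => ?_
    rw [defect_diagonal, defect_diagonal, encard_compl_range_add, encard_compl_range_gapShift]
    norm_cast
    omega

theorem defectTop_ne_of_lt [Nonempty N] {n m : ℕ} (hnm : n < m) :
    defectTop N n ≠ defectTop N m := by
  intro h
  have ht := tendsto_diagonal_gapShift (N := N) n
  rw [h] at ht
  obtain ⟨i⟩ := ‹Nonempty N›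
  obtain ⟨k, hk⟩ := ((tendsto_defectTop_iff.1 ht).2.2 i (n + 1) hnm).exists
  rw [defect_diagonal, defect_diagonal, encard_compl_range_add, encard_compl_range_gapShift] at hk
  norm_cast at hk
  omega

end NKomega

theorem nKomega_infinitely_many_polish_semigroup_topologies
    (N : Type*) [Countable N] [Nonempty N] :
    {τ : TopologicalSpace ↥(graphEnd (nKomega N)) |
      IsPolishSemigroupTop (graphEnd_comp (nKomega N)) τ}.Infinite := by
  let : TopologicalSpace N := ⊥
  have : DiscreteTopology N := ⟨rfl⟩
  refine infinite_of_injective_forall_mem (f := NKomega.defectTop N)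
    (Function.Injective.of_lt_imp_ne fun n m => NKomega.defectTop_ne_of_lt) fun n => ?_
  exact ⟨NKomega.polishSpace_defectTop n, NKomega.continuous_comp_defectTop n⟩
end

section
/- Let R be the random graph and equip End(R) with the pointwise topology. Then End(R) has automatic continuity with respect to the class of second countable topological semigroups: every semigroup homomorphism from End(R) to a second countable topological semigroup is continuous. -/
variable {G : Type*}

/-- Strong recursion along a rank function, with a choice at every step. -/
theorem exists_forall_of_rank {α β : Type*} (e : α → ℕ)
    (P : ∀ a : α, ({c // e c < e a} → β) → β → Prop) (hP : ∀ a f, ∃ b, P a f b) :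
    ∃ f : α → β, ∀ a, P a (fun c => f c.1) (f a) := by
  choose F hF using hP
  have wf : WellFounded fun c a : α => e c < e a := (measure e).wf
  refine ⟨wf.fix fun a ih => F a fun c => ih c.1 c.2, fun a => ?_⟩
  rw [wf.fix_eq]
  exact hF _ _

theorem finite_rank_le {α : Type*} {e : α → ℕ} (he : Function.Injective e) (n : ℕ) :
    {a | e a ≤ n}.Finite :=
  (Set.finite_Iic n).preimage he.injOn

theorem finite_rank_lt {α : Type*} {e : α → ℕ} (he : Function.Injective e) (n : ℕ) :
    Finite {a // e a < n} :=
  ((Set.finite_Iio n).preimage he.injOn).to_subtype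

theorem ExtensionProperty.exists_adj {G : Type*} {adj : G → G → Prop}
    (hext : ExtensionProperty adj) {U V : Set G} (hU : U.Finite) (hV : V.Finite)
    (h : Disjoint U V) :
    ∃ w, w ∉ U ∧ w ∉ V ∧ (∀ u ∈ U, adj w u) ∧ ∀ v ∈ V, ¬ adj w v := by
  lift U to Finset G using hU
  lift V to Finset G using hV
  exact hext U V fun x hx hx' => Set.disjoint_left.1 h hx hx'

/-- Every countable graph embeds in the random graph in such a way that each vertex outside the
image has only finitely many neighbours in the image. -/
theorem ExtensionProperty.exists_embedding {G L : Type*} [Countable G] [Countable L]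
    {adj : G → G → Prop} (hsymm : ∀ ⦃x y⦄, adj x y → adj y x) (hirr : ∀ x, ¬ adj x x)
    (hext : ExtensionProperty adj) {r : L → L → Prop} (rsymm : ∀ ⦃a b⦄, r a b → r b a)
    (rirr : ∀ a, ¬ r a a) :
    ∃ i : L → G, Function.Injective i ∧ (∀ a b, adj (i a) (i b) ↔ r a b) ∧
      ∀ v ∉ Set.range i, {a | adj (i a) v}.Finite := by
  obtain ⟨e, he⟩ := Countable.exists_injective_nat G
  obtain ⟨k, hk⟩ := Countable.exists_injective_nat L
  obtain ⟨i, hi⟩ := exists_forall_of_rank (β := G) k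
    (fun a f b => b ∉ Set.range f ∧ (∀ c, r a c.1 → adj b (f c)) ∧
      ∀ v ∈ (Set.range f ∪ {v | e v ≤ k a}) \ f '' {c | r a c.1}, ¬ adj b v) (by
    intro a f
    have := finite_rank_lt hk (k a)
    obtain ⟨w, h1, h2, h3, h4⟩ := hext.exists_adj (U := f '' {c | r a c.1})
      (V := (Set.range f ∪ {v | e v ≤ k a}) \ f '' {c | r a c.1}) (Set.toFinite _)
      (((Set.finite_range f).union (finite_rank_le he _)).sdiff) Set.disjoint_sdiff_right
    exact ⟨w, fun h => h2 ⟨.inl h, h1⟩, fun c hc => h3 _ ⟨c, hc, rfl⟩, h4⟩)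
  have ne_of_lt : ∀ a b, k b < k a → i a ≠ i b := fun a b h hab => (hi a).1 ⟨⟨b, h⟩, hab.symm⟩
  have inj : Function.Injective i := by
    intro a b hab
    rcases lt_trichotomy (k a) (k b) with h | h | h
    · exact absurd hab.symm (ne_of_lt _ _ h)
    · exact hk h
    · exact absurd hab (ne_of_lt _ _ h)
  have adj_of_lt : ∀ a b, k b < k a → (adj (i a) (i b) ↔ r a b) := by
    intro a b h
    refine ⟨fun hab => ?_, fun hr => (hi a).2.1 ⟨b, h⟩ hr⟩
    by_contra hr
    refine (hi a).2.2 (i b) ⟨.inl ⟨⟨b, h⟩, rfl⟩, ?_⟩ hab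
    rintro ⟨c, hc, hcb⟩
    exact hr (inj hcb ▸ hc)
  refine ⟨i, inj, fun a b => ?_, fun v hv => ?_⟩
  · rcases lt_trichotomy (k a) (k b) with h | h | h
    · exact ⟨fun h' => rsymm ((adj_of_lt _ _ h).1 (hsymm h')),
        fun h' => hsymm ((adj_of_lt _ _ h).2 (rsymm h'))⟩
    · obtain rfl := hk h
      exact iff_of_false (hirr _) (rirr _)
    · exact adj_of_lt _ _ h
  · refine (finite_rank_le hk (e v)).subset fun a ha => ?_
    by_contra h
    rw [Set.mem_ofPred_eq, not_le] at h
    refine (hi a).2.2 v ⟨.inr h.le, ?_⟩ ha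
    rintro ⟨c, -, hc⟩
    exact hv ⟨c.1, hc⟩

/-- Homomorphisms into the random graph extend along an embedding for which each vertex outside
the image has only finitely many neighbours in the image. -/
theorem ExtensionProperty.exists_extend {G L : Type*} [Countable G] {adj : G → G → Prop}
    (hsymm : ∀ ⦃x y⦄, adj x y → adj y x) (hirr : ∀ x, ¬ adj x x)
    (hext : ExtensionProperty adj)
    {i : L → G} (inj : Function.Injective i)
    (hfin : ∀ v ∉ Set.range i, {a | adj (i a) v}.Finite)
    {h : L → G} (hh : ∀ a b, adj (i a) (i b) → adj (h a) (h b)) :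
    ∃ f ∈ graphEnd adj, ∀ a, f (i a) = h a := by
  obtain ⟨e, he⟩ := Countable.exists_injective_nat G
  obtain ⟨f, hf⟩ := exists_forall_of_rank (β := G) e
    (fun v f b => (∀ a, i a = v → b = h a) ∧
      (v ∉ Set.range i → (∀ c, adj c.1 v → adj b (f c)) ∧ ∀ a, adj (i a) v → adj b (h a))) (by
    intro v f
    by_cases hv : v ∈ Set.range i
    · obtain ⟨a, rfl⟩ := hv
      exact ⟨h a, fun b hb => by rw [inj hb], fun hn => absurd ⟨a, rfl⟩ hn⟩
    · have := finite_rank_lt he (e v)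
      obtain ⟨w, -, -, hw, -⟩ := hext.exists_adj (V := ∅)
        ((Set.finite_range f).union ((hfin v hv).image h)) Set.finite_empty
        (Set.disjoint_empty _)
      exact ⟨w, fun a ha => absurd ⟨a, ha⟩ hv, fun _ =>
        ⟨fun c _ => hw _ (.inl ⟨c, rfl⟩), fun a ha => hw _ (.inr ⟨a, ha, rfl⟩)⟩⟩)
  have hfi : ∀ a, f (i a) = h a := fun a => (hf _).1 a rfl
  have key : ∀ x y, adj x y → (y ∈ Set.range i → x ∈ Set.range i) →
      (x ∉ Set.range i → y ∉ Set.range i → e y < e x) → adj (f x) (f y) := by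
    intro x y hxy h1 h2
    by_cases hx : x ∈ Set.range i
    · by_cases hy : y ∈ Set.range i
      · obtain ⟨a, rfl⟩ := hx
        obtain ⟨b, rfl⟩ := hy
        rw [hfi, hfi]
        exact hh _ _ hxy
      · obtain ⟨a, rfl⟩ := hx
        rw [hfi]
        exact hsymm (((hf y).2 hy).2 a hxy)
    · have hy : y ∉ Set.range i := fun hy => hx (h1 hy)
      exact ((hf x).2 hx).1 ⟨y, h2 hx hy⟩ (hsymm hxy)
  refine ⟨f, fun x y hxy => ?_, hfi⟩
  by_cases hx : x ∈ Set.range i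
  · exact key x y hxy (fun _ => hx) fun h => absurd hx h
  by_cases hy : y ∈ Set.range i
  · exact hsymm (key y x (hsymm hxy) (fun _ => hy) fun h => absurd hy h)
  rcases lt_trichotomy (e x) (e y) with h | h | h
  · exact hsymm (key y x (hsymm hxy) (fun h => absurd h hx) fun _ _ => h)
  · obtain rfl := he h
    exact absurd hxy (hirr _)
  · exact key x y hxy (fun h => absurd h hy) fun _ _ => h

theorem exists_first_difference (τ x : Set ℕ) (N : ℕ) :
    ∃ d ≤ N, (∀ m < d, m ∈ τ ↔ m ∈ x) ∧ (d = N ∨ ¬ (d ∈ τ ↔ d ∈ x)) := by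
  classical
  have hex : ∃ d, d = N ∨ ¬ (d ∈ τ ↔ d ∈ x) := ⟨N, .inl rfl⟩
  refine ⟨Nat.find hex, Nat.find_min' hex (.inl rfl), fun m hm => ?_, Nat.find_spec hex⟩
  by_contra h
  exact Nat.find_min hex hm (.inr h)

/-- If a sequence of endomorphisms `t n` of the random graph converges to `s`, then there are
endomorphisms `a y` and `f x`, indexed by the subsets of `ℕ`, such that `f x ∘ a x = s` and every
`f x ∘ a y` with `x ≠ y` is one of the `t n`. -/
theorem ExtensionProperty.exists_factorizations {G : Type*} [Countable G] {adj : G → G → Prop}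
    (hsymm : ∀ ⦃x y⦄, adj x y → adj y x) (hirr : ∀ x, ¬ adj x x)
    (hext : ExtensionProperty adj)
    {e : G → ℕ} {s : G → G} {t : ℕ → G → G}
    (ht : ∀ n, t n ∈ graphEnd adj) (hts : ∀ n v, e v ≤ n → t n v = s v) :
    ∃ a f : Set ℕ → G → G, (∀ x, a x ∈ graphEnd adj) ∧ (∀ x, f x ∈ graphEnd adj) ∧
      (∀ x, f x ∘ a x = s) ∧ ∀ x y, x ≠ y → ∃ n, f x ∘ a y = t n := by
  classical
  let r : G × Finset ℕ → G × Finset ℕ → Prop := fun p q =>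
    adj p.1 q.1 ∧ ∀ m, m < e p.1 → m < e q.1 → (m ∈ p.2 ↔ m ∈ q.2)
  have rsymm : ∀ ⦃p q⦄, r p q → r q p := fun p q h =>
    ⟨hsymm h.1, fun m h1 h2 => (h.2 m h2 h1).symm⟩
  obtain ⟨i, inj, hadj, hfin⟩ := hext.exists_embedding hsymm hirr rsymm fun p h => hirr _ h.1
  choose d hdN hd hd' using exists_first_difference
  have hom_of_le : ∀ x p q, r p q → e p.1 ≤ e q.1 →
      adj (t (d p.2 x (e p.1)) p.1) (t (d q.2 x (e q.1)) q.1) := by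
    rintro x ⟨u, τ⟩ ⟨v, σ⟩ ⟨huv, hc⟩ hle
    simp only at huv hc hle ⊢
    have h1 := hdN τ x (e u)
    have h2 := hd τ x (e u)
    have h3 := hd' τ x (e u)
    have h4 := hd σ x (e v)
    have h5 := hd' σ x (e v)
    simp only [Finset.mem_coe] at h2 h3 h4 h5
    generalize d τ x (e u) = m at *
    generalize d σ x (e v) = n at *
    by_cases hm : m < e u
    · have : m = n := by
        rcases lt_trichotomy m n with h | h | h
        · grind
        · exact h
        · grind
      subst this
      exact ht m _ _ huv
    · have hmu : m = e u := by omega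
      have hn : e u ≤ n := by
        by_contra hn
        grind
      rw [hts m u hmu.ge, ← hts n u hn]
      exact ht n _ _ huv
  have hf : ∀ x : Set ℕ, ∃ f ∈ graphEnd adj,
      ∀ p : G × Finset ℕ, f (i p) = t (d p.2 x (e p.1)) p.1 := by
    intro x
    refine hext.exists_extend hsymm hirr inj hfin fun p q hpq => ?_
    rw [hadj] at hpq
    rcases le_total (e p.1) (e q.1) with h | h
    · exact hom_of_le x p q hpq h
    · exact hsymm (hom_of_le x q p (rsymm hpq) h)
  choose f hfE hfi using hf
  refine ⟨fun y v => i (v, (Finset.range (e v)).filter (· ∈ y)), f, ?_, hfE, ?_, ?_⟩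
  · intro y u v huv
    rw [hadj]
    refine ⟨huv, fun m h1 h2 => ?_⟩
    simp only at h1 h2
    simp [h1, h2]
  · intro x
    funext v
    simp only [Function.comp_apply, hfi]
    refine hts _ _ ?_
    have h1 := hdN ((Finset.range (e v)).filter (· ∈ x)) x (e v)
    have h3 := hd' ((Finset.range (e v)).filter (· ∈ x)) x (e v)
    simp only [Finset.mem_coe, Finset.mem_filter, Finset.mem_range] at h3
    grind
  · intro x y hxy
    have hex : ∃ n, ¬ (n ∈ y ↔ n ∈ x) := by
      by_contra! h
      exact hxy (Set.ext fun n => (h n).symm)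
    have hn := Nat.find_spec hex
    have hmin : ∀ m < Nat.find hex, (m ∈ y ↔ m ∈ x) := fun m hm => by
      simpa using Nat.find_min hex hm
    generalize Nat.find hex = n at hn hmin
    refine ⟨n, funext fun v => ?_⟩
    simp only [Function.comp_apply, hfi]
    have h1 := hdN ((Finset.range (e v)).filter (· ∈ y)) x (e v)
    have h2 := hd ((Finset.range (e v)).filter (· ∈ y)) x (e v)
    have h3 := hd' ((Finset.range (e v)).filter (· ∈ y)) x (e v)
    simp only [Finset.mem_coe, Finset.mem_filter, Finset.mem_range] at h2 h3
    generalize d ((Finset.range (e v)).filter (· ∈ y)) x (e v) = m at *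
    by_cases hm : m < e v
    · have : m = n := by
        rcases lt_trichotomy m n with h | h | h
        · grind
        · exact h
        · grind
      rw [this]
    · have : e v ≤ n := by
        by_contra h
        grind
      rw [hts m v (by omega), hts n v this]

/-- In a second countable space no uncountable family is relatively discrete. -/
theorem exists_ne_mem_of_uncountable {T κ : Type*} [TopologicalSpace T]
    [SecondCountableTopology T] [Uncountable κ] (a : κ → T) (W : κ → Set T)
    (hW : ∀ x, IsOpen (W x)) (ha : ∀ x, a x ∈ W x) : ∃ x y, x ≠ y ∧ a y ∈ W x := by
  by_contra! h
  have hB := TopologicalSpace.isBasis_countableBasis T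
  choose B hBm haB hBW using fun x => hB.exists_subset_of_mem_open (ha x) (hW x)
  have hinj : Function.Injective fun x => (⟨B x, hBm x⟩ : TopologicalSpace.countableBasis T) := by
    intro x y hxy
    by_contra hne
    have hBxy : B x = B y := congrArg Subtype.val hxy
    exact h x y hne (hBW x (hBxy ▸ haB y))
  have := (TopologicalSpace.countable_countableBasis T).to_subtype
  exact not_countable (α := κ) hinj.countable

theorem isOpen_pointwiseTop_of_forall {X : Type*} {S : Set (X → X)} {e : X → ℕ}
    (he : Function.Injective e) {A : Set S}
    (hA : ∀ s ∈ A, ∃ n, ∀ t : S, (∀ v, e v ≤ n → t.1 v = s.1 v) → t ∈ A) :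
    @IsOpen S (pointwiseTop X S) A := by
  let _ := pointwiseTop X S
  refine isOpen_iff_forall_mem_open.2 fun s hs => ?_
  obtain ⟨n, hn⟩ := hA s hs
  refine ⟨⋂ v ∈ {v | e v ≤ n}, {t : S | t.1 v = s.1 v}, fun t ht => hn t (by simpa using ht),
    (finite_rank_le he n).isOpen_biInter fun v _ => .basic _ ⟨v, _, rfl⟩, by simp⟩

/-- Automatic continuity for `End(R)` of the random graph `R`: every semigroup
homomorphism from `End(R)` (with the pointwise topology) to a second countable
topological semigroup is continuous. -/
theorem randomGraph_end_automatic_continuity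
    {G : Type*} [Countable G] (adj : G → G → Prop)
    (hsymm : Symmetric adj) (hirr : Irreflexive adj)
    (hext : ExtensionProperty adj) :
    ∀ (T : Type*) (τT : TopologicalSpace T) (mul : T → T → T),
      (∀ a b c : T, mul (mul a b) c = mul a (mul b c)) →
      @SecondCountableTopology T τT →
      @Continuous (T × T) T (@instTopologicalSpaceProd T T τT τT) τT
        (fun p => mul p.1 p.2) →
      ∀ φ : ↥(graphEnd adj) → T,
        (∀ f g : ↥(graphEnd adj),
          φ ⟨g.1 ∘ f.1, graphEnd_comp adj f.1 f.2 g.1 g.2⟩ = mul (φ f) (φ g)) →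
        @Continuous ↥(graphEnd adj) T (pointwiseTop G (graphEnd adj)) τT φ := by
  intro T τT mul _ _ hmul φ hφ
  obtain ⟨e, he⟩ := Countable.exists_injective_nat G
  let _ := pointwiseTop G (graphEnd adj)
  refine continuous_def.2 fun W hW => isOpen_pointwiseTop_of_forall he fun s hs => ?_
  by_contra! hcon
  choose t hts htW using hcon
  obtain ⟨a, f, ha, hf, hfa, hfay⟩ := hext.exists_factorizations hsymm hirr
    (t := fun n => (t n).1) (fun n => (t n).2) hts
  have : Uncountable (Set ℕ) := ⟨fun h => by
    obtain ⟨g, hg⟩ := Countable.exists_injective_nat (Set ℕ)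
    exact Function.cantor_injective g hg⟩
  obtain ⟨x, y, hxy, hmem⟩ := exists_ne_mem_of_uncountable
    (fun y => φ ⟨a y, ha y⟩) (fun x => {z | mul z (φ ⟨f x, hf x⟩) ∈ W})
    (fun x => hW.preimage (hmul.comp (Continuous.prodMk_left (φ ⟨f x, hf x⟩))))
    (fun x => by
      simp only [Set.mem_ofPred_eq, ← hφ, hfa]
      exact hs)
  obtain ⟨n, hn⟩ := hfay x y hxy
  simp only [Set.mem_ofPred_eq, ← hφ, hn] at hmem
  exact htW n hmem
end
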